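/- Let X ⊆ ℝ^n be closed with nonempty interior, Y ⊆ ℝ^m nonempty and open, Φ : X × Y → ℝ continuous relative to X × Y and continuously differentiable on int(X) × Y, and let g satisfy Assumption (G). Then for every y₀ ∈ Y there exists a compact neighborhood V ⊆ Y of y₀ such that the set Z := {x ∈ (∂_Φ g)^{-1}(y) : y ∈ V} is compact, g restricted to Z is continuous, and g^Φ(y) = max_{x ∈ Z} (Φ(x, y) − g(x)) for all y ∈ V. Consequently g^Φ is lower-C¹ on Y. -/

import Mathlib

set_option linter.unusedVariables false

open Filter Topology Metric Set Bornology
open scoped RealInnerProductSpace NNReal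

noncomputable section

variable {E F : Type*} [NormedAddCommGroup E] [InnerProductSpace ℝ E] [CompleteSpace E]
  [NormedAddCommGroup F] [InnerProductSpace ℝ F] [CompleteSpace F]

/-- Gradient of the coupling `Φ` in its first argument. -/
def gradx (Φ : E → F → ℝ) (x : E) (y : F) : E :=
  gradient (fun x' => Φ x' y) x

/-- Gradient of the coupling `Φ` in its second argument. -/
def grady (Φ : E → F → ℝ) (x : E) (y : F) : F :=
  gradient (fun y' => Φ x y') y

/-- The Φ-conjugate of `f` relative to `X`: `f^Φ(y) = sup_{x ∈ X} (Φ(x,y) − f(x))`. -/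
def phiConj (X : Set E) (Φ : E → F → ℝ) (f : E → EReal) (y : F) : EReal :=
  ⨆ x ∈ X, ((Φ x y : EReal) - f x)

/-- The Φ-biconjugate of `f`: `f^{ΦΦ}(x) = sup_{y ∈ Y} (Φ(x,y) − f^Φ(y))`. -/
def phiBiconj (X : Set E) (Y : Set F) (Φ : E → F → ℝ) (f : E → EReal) (x : E) : EReal :=
  ⨆ y ∈ Y, ((Φ x y : EReal) - phiConj X Φ f y)

/-- `f` is Φ-convex on `X`: `f` is a pointwise supremum over `X` of functions
`x ↦ Φ(x, yᵢ) − βᵢ` with `yᵢ ∈ Y` (the empty index set giving `f ≡ −∞`). -/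
def PhiConvexOn (X : Set E) (Y : Set F) (Φ : E → F → ℝ) (f : E → EReal) : Prop :=
  ∃ (ι : Type) (yi : ι → F) (βi : ι → EReal),
    (∀ i, yi i ∈ Y) ∧ ∀ x ∈ X, f x = ⨆ i, ((Φ x (yi i) : EReal) - βi i)

/-- The Φ-subdifferential of `f` at `xb`:
`y ∈ ∂_Φ f(xb)` iff `y ∈ Y` and `f(x) ≥ f(xb) + Φ(x,y) − Φ(xb,y)` for all `x ∈ X`. -/
def phiSubdiff (X : Set E) (Y : Set F) (Φ : E → F → ℝ) (f : E → EReal) (xb : E) : Set F :=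
  {y | y ∈ Y ∧ ∀ x ∈ X, f xb + ((Φ x y - Φ xb y : ℝ) : EReal) ≤ f x}

/-- The Φ-subdifferential of a function `gc` on `Y` (such as `f^Φ`) at `yb`:
`x ∈ ∂_Φ gc(yb)` iff `x ∈ X` and `gc(y) ≥ gc(yb) + Φ(x,y) − Φ(x,yb)` for all `y ∈ Y`. -/
def phiSubdiffDual (X : Set E) (Y : Set F) (Φ : E → F → ℝ) (gc : F → EReal) (yb : F) : Set E :=
  {x | x ∈ X ∧ ∀ y ∈ Y, gc yb + ((Φ x y - Φ x yb : ℝ) : EReal) ≤ gc y}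

/-- The generalized proximal mapping `(∂_Φ g)^{-1}(y) = argmin_{x ∈ X} (g(x) − Φ(x,y))`. -/
def proxSet (X : Set E) (Φ : E → F → ℝ) (g : E → EReal) (y : F) : Set E :=
  {x | x ∈ X ∧ ∀ x' ∈ X, g x - ((Φ x y : ℝ) : EReal) ≤ g x' - ((Φ x' y : ℝ) : EReal)}

/-- Assumption (G): `g` is proper and lsc on `X`, `g − Φ(·,y)` is level-bounded in `x`
locally uniformly in `y`, and the range of the generalized proximal mapping lies in `int X`. -/
structure AssumptionG (X : Set E) (Y : Set F) (Φ : E → F → ℝ) (g : E → EReal) : Prop where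
  proper : ∃ x ∈ X, g x ≠ ⊤
  ne_bot : ∀ x, g x ≠ ⊥
  lsc : LowerSemicontinuousOn g X
  levelBounded : ∀ yb ∈ Y, ∀ α : ℝ, ∃ V ∈ 𝓝 yb, ∃ B : Set E, IsBounded B ∧
    ∀ y ∈ V ∩ Y, {x | x ∈ X ∧ g x - ((Φ x y : ℝ) : EReal) ≤ (α : EReal)} ⊆ B
  ran_interior : ∀ y ∈ Y, proxSet X Φ g y ⊆ interior X

/-- `v` is a regular (Fréchet) subgradient of `f` at `x`. -/
def IsFSubgrad (f : E → EReal) (x v : E) : Prop :=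
  f x ≠ ⊤ ∧ f x ≠ ⊥ ∧ ∀ ε > (0 : ℝ), ∃ δ > (0 : ℝ), ∀ x', ‖x' - x‖ < δ →
    f x + ((⟪v, x' - x⟫ - ε * ‖x' - x‖ : ℝ) : EReal) ≤ f x'

/-- `v` is a limiting (Mordukhovich) subgradient of `f` at `x`. -/
def IsLSubgrad (f : E → EReal) (x v : E) : Prop :=
  f x ≠ ⊤ ∧ f x ≠ ⊥ ∧ ∃ xs vs : ℕ → E,
    Tendsto xs atTop (𝓝 x) ∧ Tendsto (fun ν => f (xs ν)) atTop (𝓝 (f x)) ∧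
    Tendsto vs atTop (𝓝 v) ∧ ∀ ν, IsFSubgrad f (xs ν) (vs ν)

/-- `f` is locally lower semicontinuous at `xb`. -/
def LocallyLscAt (f : E → EReal) (xb : E) : Prop :=
  ∃ ε > (0 : ℝ), ∀ α : EReal, α ≤ f xb + ((ε : ℝ) : EReal) →
    IsClosed {x | x ∈ closedBall xb ε ∧ f x ≤ α}

/-- `g` is prox-regular at `xb` for `vb` with parameter `r`. -/
def ProxRegularAt (g : E → EReal) (xb vb : E) (r : ℝ) : Prop :=
  g xb ≠ ⊤ ∧ g xb ≠ ⊥ ∧ LocallyLscAt g xb ∧ IsLSubgrad g xb vb ∧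
  ∃ ε > (0 : ℝ), ∀ x x' v : E, ‖x' - xb‖ ≤ ε → ‖x - xb‖ ≤ ε →
    g x ≤ g xb + ((ε : ℝ) : EReal) → IsLSubgrad g x v → ‖v - vb‖ ≤ ε →
    g x + ((⟪v, x' - x⟫ - r / 2 * ‖x' - x‖ ^ 2 : ℝ) : EReal) ≤ g x'

/-- `g` is Φ-prox-regular at `xb` for `(vb, yb)`. -/
def PhiProxRegularAt (X : Set E) (Φ : E → F → ℝ) (g : E → EReal)
    (xb vb : E) (yb : F) : Prop :=
  g xb ≠ ⊤ ∧ g xb ≠ ⊥ ∧ LocallyLscAt g xb ∧ IsLSubgrad g xb vb ∧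
  ∃ ε > (0 : ℝ), ∀ (x x' v : E) (y : F), ‖x' - xb‖ ≤ ε → ‖x - xb‖ ≤ ε →
    g x - g xb ≤ ((ε : ℝ) : EReal) → IsLSubgrad g x v → ‖v - vb‖ ≤ ε → ‖y - yb‖ ≤ ε →
    v = gradx Φ x y →
    g x + ((Φ x' y - Φ x y : ℝ) : EReal) ≤ g x'

/-- `g` is Φ-prox-regular at `xb` for `(vb, yb)` with the subgradient inequality strict
whenever `x' ≠ x`. -/
def PhiProxRegularStrictAt (X : Set E) (Φ : E → F → ℝ) (g : E → EReal)
    (xb vb : E) (yb : F) : Prop :=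
  PhiProxRegularAt X Φ g xb vb yb ∧
  ∃ ε > (0 : ℝ), ∀ (x x' v : E) (y : F), ‖x' - xb‖ ≤ ε → ‖x - xb‖ ≤ ε →
    g x - g xb ≤ ((ε : ℝ) : EReal) → IsLSubgrad g x v → ‖v - vb‖ ≤ ε → ‖y - yb‖ ≤ ε →
    v = gradx Φ x y → x' ≠ x →
    g x + ((Φ x' y - Φ x y : ℝ) : EReal) < g x'

/-- The `g`-attentive `ε`-localization of the limiting subdifferential `∂g` at `xb` for `vb`. -/
def gAttentiveLoc (g : E → EReal) (xb vb : E) (ε : ℝ) (x : E) : Set E :=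
  {v | ‖x - xb‖ < ε ∧ g x < g xb + ((ε : ℝ) : EReal) ∧ IsLSubgrad g x v ∧ ‖v - vb‖ < ε}

/-- `Φ` is twist: for each `x ∈ int X` the map `y ↦ ∇ₓΦ(x,y)` is injective on `Y`. -/
def IsTwist (X : Set E) (Y : Set F) (Φ : E → F → ℝ) : Prop :=
  ∀ x ∈ interior X, Set.InjOn (fun y => gradx Φ x y) Y

/-- `Φ` is a local strong twist at `(xb, yb)`: with `vb := ∇ₓΦ(xb,yb)` there is a unique
continuously differentiable map `G(x,v)` near `(xb,vb)`, with values in `Y`, such that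
`G(xb,vb) = yb` and `∇ₓΦ(x, G(x,v)) = v` near `(xb,vb)`. -/
def IsLocalStrongTwist (Y : Set F) (Φ : E → F → ℝ) (xb : E) (yb : F) : Prop :=
  ∃ (G : E × E → F) (U : Set (E × E)), IsOpen U ∧ (xb, gradx Φ xb yb) ∈ U ∧
    ContDiffOn ℝ 1 G U ∧ G (xb, gradx Φ xb yb) = yb ∧ (∀ p ∈ U, G p ∈ Y) ∧
    (∀ p ∈ U, gradx Φ p.1 (G p) = p.2) ∧
    ∀ (G' : E × E → F) (U' : Set (E × E)), IsOpen U' → (xb, gradx Φ xb yb) ∈ U' →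
      ContDiffOn ℝ 1 G' U' → G' (xb, gradx Φ xb yb) = yb → (∀ p ∈ U', G' p ∈ Y) →
      (∀ p ∈ U', gradx Φ p.1 (G' p) = p.2) →
      ∀ᶠ p in 𝓝 (xb, gradx Φ xb yb), G' p = G p

/-- `Φ` is a global strong twist. -/
def IsGlobalStrongTwist (X : Set E) (Y : Set F) (Φ : E → F → ℝ) : Prop :=
  IsTwist X Y Φ ∧ ∀ xb ∈ interior X, ∀ yb ∈ Y, IsLocalStrongTwist Y Φ xb yb

/-- `σ` is a single-valued localization of the set-valued map `Fm` around `pb` for `qb`,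
with domain of localization `U`. -/
def IsSVLocalization {α β : Type*} [TopologicalSpace α] [TopologicalSpace β]
    (Fm : α → Set β) (pb : α) (qb : β) (σ : α → β) (U : Set α) : Prop :=
  U ∈ 𝓝 pb ∧ σ pb = qb ∧ ∃ V ∈ 𝓝 qb, ∀ p ∈ U, Fm p ∩ V = {σ p}

/-- `H` is a first-order approximation to `Fm` at `xb`. -/
def IsFOApprox {α β : Type*} [NormedAddCommGroup α] [NormedAddCommGroup β]
    (Fm H : α → β) (xb : α) : Prop :=
  H xb = Fm xb ∧ ∀ ε > (0 : ℝ), ∃ V ∈ 𝓝 xb, ∀ x ∈ V, ‖Fm x - H x‖ ≤ ε * ‖x - xb‖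

/-- `H` is a strict first-order approximation to `Fm` at `xb`. -/
def IsStrictFOApprox {α β : Type*} [NormedAddCommGroup α] [NormedAddCommGroup β]
    (Fm H : α → β) (xb : α) : Prop :=
  H xb = Fm xb ∧ ∀ ε > (0 : ℝ), ∃ V ∈ 𝓝 xb, ∀ x ∈ V, ∀ x' ∈ V,
    ‖Fm x - H x - (Fm x' - H x')‖ ≤ ε * ‖x - x'‖

/-- Sequential epi-convergence of `fs` to `f`. -/
def EpiConvergesSeq (fs : ℕ → E → EReal) (f : E → EReal) : Prop :=
  ∀ w : E,
    (∀ ws : ℕ → E, Tendsto ws atTop (𝓝 w) →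
      f w ≤ Filter.liminf (fun ν => fs ν (ws ν)) atTop) ∧
    (∃ ws : ℕ → E, Tendsto ws atTop (𝓝 w) ∧
      Filter.limsup (fun ν => fs ν (ws ν)) atTop ≤ f w)

/-- `g` is strictly twice epi-differentiable at `xb` for `vb`: the second-order difference
quotients epi-converge to a common limit along every sequence `tₙ ↘ 0`,
`(xₙ, vₙ) → (xb, vb)` with `vₙ ∈ ∂g(xₙ)` and `g(xₙ) → g(xb)`. -/
def StrictTwiceEpiDiff (g : E → EReal) (xb vb : E) : Prop :=
  ∃ h : E → EReal, ∀ (ts : ℕ → ℝ) (xs vs : ℕ → E),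
    (∀ ν, 0 < ts ν) → Tendsto ts atTop (𝓝 0) →
    Tendsto xs atTop (𝓝 xb) → Tendsto vs atTop (𝓝 vb) →
    (∀ ν, IsLSubgrad g (xs ν) (vs ν)) →
    Tendsto (fun ν => g (xs ν)) atTop (𝓝 (g xb)) →
    EpiConvergesSeq (fun ν w =>
      ((2 / (ts ν) ^ 2 : ℝ) : EReal) *
        (g (xs ν + ts ν • w) - g (xs ν) - ((ts ν * ⟪vs ν, w⟫ : ℝ) : EReal))) h

/-- `g` is prox-bounded with threshold `lamg`. -/
def ProxBoundedWith (g : E → EReal) (lamg : ℝ) : Prop :=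
  ∀ lam : ℝ, 0 < lam → lam < lamg → ∃ (y : E) (b : ℝ), ∀ x : E,
    (b : EReal) ≤ g x + ((1 / (2 * lam) * ‖x - y‖ ^ 2 : ℝ) : EReal)

/-- `φ` is lower-C¹ on the open set `O`: locally a max over a compact index set `Z`
of functions `h(x, ·)` that are continuous in `(x,y)` together with their `y`-gradients. -/
def LowerC1On (φ : F → ℝ) (O : Set F) : Prop :=
  ∀ y₀ ∈ O, ∃ (V : Set F) (Z : Set E) (h : E → F → ℝ) (hy : E → F → F),
    V ∈ 𝓝 y₀ ∧ IsCompact Z ∧ Z.Nonempty ∧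
    ContinuousOn (fun p : E × F => h p.1 p.2) (Z ×ˢ V) ∧
    ContinuousOn (fun p : E × F => hy p.1 p.2) (Z ×ˢ V) ∧
    (∀ x ∈ Z, ∀ y ∈ V, HasGradientAt (h x) (hy x y) y) ∧
    ∀ y ∈ V, (∃ x ∈ Z, φ y = h x y) ∧ ∀ x ∈ Z, h x y ≤ φ y

set_option linter.unusedSectionVars false

section Conjugate

variable {X : Set E} {Y : Set F} {Φ : E → F → ℝ} {g : E → EReal}

theorem ereal_sub_coe_le_iff {a b : EReal} {r s : ℝ} (hb : b ≠ ⊥) (hb' : b ≠ ⊤) :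
    a - (r : EReal) ≤ b - (s : EReal) ↔ a ≤ ((r - s + b.toReal : ℝ) : EReal) := by
  lift b to ℝ using ⟨hb', hb⟩
  induction a with
  | bot => simp
  | top =>
    rw [EReal.toReal_coe, EReal.top_sub_coe, ← EReal.coe_sub, top_le_iff, top_le_iff]
    exact iff_of_false (EReal.coe_ne_top _) (EReal.coe_ne_top _)
  | coe a =>
    norm_cast
    rw [EReal.toReal_coe]
    constructor <;> intro h <;> linarith

theorem mem_proxSet_iff (hbot : ∀ x, g x ≠ ⊥) {x : E} {y : F} :
    x ∈ proxSet X Φ g y ↔ x ∈ X ∧ ∀ x' ∈ X, g x' ≠ ⊤ →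
      g x ≤ ((Φ x y - Φ x' y + (g x').toReal : ℝ) : EReal) := by
  refine and_congr_right fun _ => forall₂_congr fun x' _ => ?_
  by_cases hx' : g x' = ⊤
  · simp [hx']
  · simp only [ne_eq, hx', not_false_eq_true, forall_true_left]
    exact ereal_sub_coe_le_iff (hbot x') hx'

theorem AssumptionG.ne_top_of_mem_proxSet (hG : AssumptionG X Y Φ g) {x : E} {y : F}
    (hx : x ∈ proxSet X Φ g y) : g x ≠ ⊤ := by
  obtain ⟨x₁, hx₁, htop⟩ := hG.proper
  exact ne_top_of_le_ne_top (EReal.coe_ne_top _)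
    (((mem_proxSet_iff hG.ne_bot).1 hx).2 x₁ hx₁ htop)

theorem AssumptionG.toReal_le_of_mem_proxSet (hG : AssumptionG X Y Φ g) {x x' : E} {y : F}
    (hx : x ∈ proxSet X Φ g y) (hx' : x' ∈ X) (htop : g x' ≠ ⊤) :
    (g x).toReal ≤ Φ x y - Φ x' y + (g x').toReal := by
  have h := ((mem_proxSet_iff hG.ne_bot).1 hx).2 x' hx' htop
  rwa [← EReal.coe_toReal (hG.ne_top_of_mem_proxSet hx) (hG.ne_bot x),
    EReal.coe_le_coe_iff] at h

theorem sub_le_phiConj {x : E} {y : F} (hx : x ∈ X) :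
    (Φ x y : EReal) - g x ≤ phiConj X Φ g y :=
  le_iSup₂ (f := fun x (_ : x ∈ X) => (Φ x y : EReal) - g x) x hx

theorem phiConj_eq_of_mem_proxSet (hbot : ∀ x, g x ≠ ⊥) {x : E} {y : F}
    (hx : x ∈ proxSet X Φ g y) : phiConj X Φ g y = (Φ x y : EReal) - g x := by
  refine le_antisymm (iSup₂_le fun x' hx' => ?_) (sub_le_phiConj hx.1)
  have h := EReal.neg_le_neg_iff.2 (hx.2 x' hx')
  rwa [EReal.neg_sub (.inl (hbot x')) (.inr (EReal.coe_ne_top _)),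
    EReal.neg_sub (.inl (hbot x)) (.inr (EReal.coe_ne_top _)), add_comm, add_comm _ (Φ x y : EReal),
    ← sub_eq_add_neg, ← sub_eq_add_neg] at h

theorem lowerSemicontinuousOn_sub_coe (hlsc : LowerSemicontinuousOn g X) {φ : E → ℝ}
    (hφ : ContinuousOn φ X) : LowerSemicontinuousOn (fun x => g x - (φ x : EReal)) X := by
  have hc : ContinuousOn (fun x => ((-φ x : ℝ) : EReal)) X :=
    continuous_coe_real_ereal.comp_continuousOn hφ.neg
  refine hlsc.add' hc.lowerSemicontinuousOn fun x _ => ?_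
  exact EReal.continuousAt_add (.inr (EReal.coe_ne_bot _)) (.inr (EReal.coe_ne_top _))

/-- Near each point of `Y` the generalized proximal mapping is nonempty-valued and takes its
values in a fixed compact subset of `X`. -/
theorem AssumptionG.exists_isCompact_proxSet_subset [ProperSpace E] [ProperSpace F]
    (hG : AssumptionG X Y Φ g) (hX : IsClosed X) (hY : IsOpen Y)
    (hΦ : ContinuousOn (fun p : E × F => Φ p.1 p.2) (X ×ˢ Y)) {y₀ : F} (hy₀ : y₀ ∈ Y) :
    ∃ V : Set F, IsCompact V ∧ V ⊆ Y ∧ V ∈ 𝓝 y₀ ∧ ∃ K ⊆ X, IsCompact K ∧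
      ∀ y ∈ V, (proxSet X Φ g y).Nonempty ∧ proxSet X Φ g y ⊆ K := by
  obtain ⟨x₁, hx₁, htop⟩ := hG.proper
  obtain ⟨W, hW, B, hB, hWB⟩ := hG.levelBounded y₀ hy₀ ((g x₁).toReal - Φ x₁ y₀ + 1)
  have hcont : ContinuousAt (Φ x₁) y₀ :=
    (hΦ.comp (f := fun y => (x₁, y)) (by fun_prop) fun y hy => ⟨hx₁, hy⟩).continuousAt
      (hY.mem_nhds hy₀)
  have hnear : {y | Φ x₁ y₀ - 1 < Φ x₁ y} ∈ 𝓝 y₀ :=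
    hcont.eventually_const_lt (sub_one_lt _)
  obtain ⟨V, hV, hVsub, hVc⟩ := local_compact_nhds
    (inter_mem (inter_mem hW (hY.mem_nhds hy₀)) hnear)
  have hKc : IsCompact (X ∩ closure B) := hB.isCompact_closure.inter_left hX
  refine ⟨V, hVc, fun y hy => (hVsub hy).1.2, hV, X ∩ closure B, inter_subset_left, hKc,
    fun y hy => ?_⟩
  obtain ⟨⟨hyW, hyY⟩, hyn⟩ := hVsub hy
  have hlevel {x : E} (hx : x ∈ X)
      (hle : g x - (Φ x y : EReal) ≤ g x₁ - (Φ x₁ y : EReal)) : x ∈ X ∩ closure B := by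
    refine ⟨hx, subset_closure (hWB y ⟨hyW, hyY⟩ ⟨hx, hle.trans ?_⟩)⟩
    rw [← EReal.coe_toReal htop (hG.ne_bot x₁), ← EReal.coe_sub, EReal.coe_le_coe_iff,
      EReal.toReal_coe]
    simp only [mem_ofPred_eq] at hyn
    linarith
  constructor
  · have hφ : ContinuousOn (fun x => Φ x y) X :=
      hΦ.comp (f := fun x => (x, y)) (by fun_prop) fun x hx => ⟨hx, hyY⟩
    have hx₁K := hlevel hx₁ le_rfl
    obtain ⟨x, hxK, hmin⟩ := ((lowerSemicontinuousOn_sub_coe hG.lsc hφ).mono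
      inter_subset_left).exists_isMinOn ⟨x₁, hx₁K⟩ hKc
    refine ⟨x, hxK.1, fun x' hx' => ?_⟩
    rcases le_total (g x' - (Φ x' y : EReal)) (g x₁ - (Φ x₁ y : EReal)) with h | h
    · exact hmin (hlevel hx' h)
    · exact (hmin hx₁K).trans h
  · exact fun x hx => hlevel hx.1 (hx.2 x₁ hx₁)

theorem AssumptionG.isClosed_graph_proxSet (hG : AssumptionG X Y Φ g) {K : Set E} {V : Set F}
    (hK : IsClosed K) (hV : IsClosed V) (hKX : K ⊆ X) (hVY : V ⊆ Y)
    (hΦ : ContinuousOn (fun p : E × F => Φ p.1 p.2) (X ×ˢ Y)) :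
    IsClosed {p : E × F | p ∈ K ×ˢ V ∧ p.1 ∈ proxSet X Φ g p.2} := by
  obtain ⟨x₁, hx₁, htop⟩ := hG.proper
  have hepi := (lowerSemicontinuousOn_iff_isClosed_epigraph hK).1 (hG.lsc.mono hKX)
  have hcl (x' : E) (hx' : x' ∈ X) :
      IsClosed ((K ×ˢ V) ∩ (fun p : E × F =>
        (p.1, ((Φ p.1 p.2 - Φ x' p.2 + (g x').toReal : ℝ) : EReal))) ⁻¹'
          {q : E × EReal | q.1 ∈ K ∧ g q.1 ≤ q.2}) := by
    refine ContinuousOn.preimage_isClosed_of_isClosed ?_ (hK.prod hV) hepi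
    have h₁ : ContinuousOn (fun p : E × F => Φ p.1 p.2) (K ×ˢ V) :=
      hΦ.mono (prod_mono hKX hVY)
    have h₂ : ContinuousOn (fun p : E × F => Φ x' p.2) (K ×ˢ V) :=
      hΦ.comp (f := fun p : E × F => (x', p.2)) (by fun_prop) fun p hp => ⟨hx', hVY hp.2⟩
    exact continuousOn_fst.prodMk (continuous_coe_real_ereal.comp_continuousOn
      ((h₁.sub h₂).add continuousOn_const))
  have heq : {p : E × F | p ∈ K ×ˢ V ∧ p.1 ∈ proxSet X Φ g p.2} =
      ⋂ x' ∈ {x' | x' ∈ X ∧ g x' ≠ ⊤}, (K ×ˢ V) ∩ (fun p : E × F =>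
        (p.1, ((Φ p.1 p.2 - Φ x' p.2 + (g x').toReal : ℝ) : EReal))) ⁻¹'
          {q : E × EReal | q.1 ∈ K ∧ g q.1 ≤ q.2} := by
    ext p
    simp only [mem_ofPred_eq, mem_iInter, mem_inter_iff, mem_preimage,
      mem_proxSet_iff hG.ne_bot]
    constructor
    · rintro ⟨hp, -, h⟩ x' ⟨hx', ht⟩
      exact ⟨hp, hp.1, h x' hx' ht⟩
    · intro h
      have hp := (h x₁ ⟨hx₁, htop⟩).1
      exact ⟨hp, hKX hp.1, fun x' hx' ht => (h x' ⟨hx', ht⟩).2.2⟩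
  rw [heq]
  exact isClosed_biInter fun x' hx' => hcl x' hx'.1

theorem AssumptionG.isCompact_biUnion_proxSet (hG : AssumptionG X Y Φ g) {K : Set E} {V : Set F}
    (hK : IsCompact K) (hV : IsCompact V) (hKX : K ⊆ X) (hVY : V ⊆ Y)
    (hΦ : ContinuousOn (fun p : E × F => Φ p.1 p.2) (X ×ˢ Y))
    (hsub : ∀ y ∈ V, proxSet X Φ g y ⊆ K) : IsCompact (⋃ y ∈ V, proxSet X Φ g y) := by
  have hc : IsCompact {p : E × F | p ∈ K ×ˢ V ∧ p.1 ∈ proxSet X Φ g p.2} :=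
    (hK.prod hV).of_isClosed_subset
      (hG.isClosed_graph_proxSet hK.isClosed hV.isClosed hKX hVY hΦ) fun p hp => hp.1
  convert hc.image continuous_fst using 1
  ext x
  simp only [mem_iUnion, exists_prop, mem_image, mem_ofPred_eq, mem_prod, Prod.exists,
    exists_and_right, exists_eq_right]
  exact ⟨fun ⟨y, hy, hx⟩ => ⟨y, ⟨hsub y hy hx, hy⟩, hx⟩, fun ⟨y, h, hx⟩ => ⟨y, h.2, hx⟩⟩

theorem AssumptionG.continuousOn_toReal_biUnion_proxSet (hG : AssumptionG X Y Φ g)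
    {K : Set E} {V : Set F} (hK : IsCompact K) (hV : IsCompact V) (hKX : K ⊆ X) (hVY : V ⊆ Y)
    (hΦ : ContinuousOn (fun p : E × F => Φ p.1 p.2) (X ×ˢ Y))
    (hsub : ∀ y ∈ V, proxSet X Φ g y ⊆ K) :
    ContinuousOn (fun x => (g x).toReal) (⋃ y ∈ V, proxSet X Φ g y) := by
  have huc := (hK.prod hV).uniformContinuousOn_of_continuous (hΦ.mono (prod_mono hKX hVY))
  rw [Metric.uniformContinuousOn_iff] at huc
  refine Metric.continuousOn_iff.2 fun x hx ε hε => ?_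
  obtain ⟨δ, hδ, hΦδ⟩ := huc ε hε
  refine ⟨δ, hδ, fun x' hx' hdist => ?_⟩
  simp only [mem_iUnion, exists_prop] at hx hx'
  obtain ⟨y, hy, hxy⟩ := hx
  obtain ⟨y', hy', hxy'⟩ := hx'
  have hclose (z : F) (hz : z ∈ V) : |Φ x' z - Φ x z| < ε :=
    hΦδ (x', z) ⟨hsub y' hy' hxy', hz⟩ (x, z) ⟨hsub y hy hxy, hz⟩
      (by simpa [Prod.dist_eq] using hdist)
  have h₁ := hG.toReal_le_of_mem_proxSet hxy hxy'.1 (hG.ne_top_of_mem_proxSet hxy')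
  have h₂ := hG.toReal_le_of_mem_proxSet hxy' hxy.1 (hG.ne_top_of_mem_proxSet hxy)
  have h₃ := abs_lt.1 (hclose y hy)
  have h₄ := abs_lt.1 (hclose y' hy')
  rw [Real.dist_eq, abs_lt]
  constructor <;> linarith

theorem hasGradientAt_snd {h : E × F → ℝ} {x : E} {y : F} (hd : DifferentiableAt ℝ h (x, y)) :
    HasGradientAt (fun y' => h (x, y')) ((InnerProductSpace.toDual ℝ F).symm
      ((fderiv ℝ h (x, y)).comp (ContinuousLinearMap.inr ℝ E F))) y := by
  apply HasFDerivAt.hasGradientAt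
  exact hd.hasFDerivAt.comp y (hasFDerivAt_prodMk_right x y)

theorem continuousOn_gradient_snd {h : E × F → ℝ} {O : Set (E × F)} (hO : IsOpen O)
    (hh : ContDiffOn ℝ 1 h O) :
    ContinuousOn (fun p : E × F => (InnerProductSpace.toDual ℝ F).symm
      ((fderiv ℝ h p).comp (ContinuousLinearMap.inr ℝ E F))) O :=
  (InnerProductSpace.toDual ℝ F).symm.continuous.comp_continuousOn
    ((hh.continuousOn_fderiv_of_isOpen hO le_rfl).clm_comp continuousOn_const)

end Conjugate

theorem phi_conjugate_lower_C1 {n m : ℕ}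
    (X : Set (EuclideanSpace ℝ (Fin n))) (Y : Set (EuclideanSpace ℝ (Fin m)))
    (Φ : EuclideanSpace ℝ (Fin n) → EuclideanSpace ℝ (Fin m) → ℝ)
    (hXcl : IsClosed X) (hXint : (interior X).Nonempty)
    (hYne : Y.Nonempty) (hYop : IsOpen Y)
    (hΦc : ContinuousOn (fun p : (EuclideanSpace ℝ (Fin n)) × (EuclideanSpace ℝ (Fin m)) => Φ p.1 p.2) (X ×ˢ Y))
    (hΦd : ContDiffOn ℝ 1 (fun p : (EuclideanSpace ℝ (Fin n)) × (EuclideanSpace ℝ (Fin m)) => Φ p.1 p.2) ((interior X) ×ˢ Y))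
    (g : EuclideanSpace ℝ (Fin n) → EReal) (hG : AssumptionG X Y Φ g) :
    (∀ y0 ∈ Y, ∃ V : Set (EuclideanSpace ℝ (Fin m)), IsCompact V ∧ V ⊆ Y ∧ V ∈ 𝓝 y0 ∧
      IsCompact (⋃ y ∈ V, proxSet X Φ g y) ∧
      ContinuousOn (fun x => (g x).toReal) (⋃ y ∈ V, proxSet X Φ g y) ∧
      ∀ y ∈ V, (∃ x ∈ ⋃ y' ∈ V, proxSet X Φ g y',
          phiConj X Φ g y = (Φ x y : EReal) - g x) ∧
        ∀ x ∈ ⋃ y' ∈ V, proxSet X Φ g y', (Φ x y : EReal) - g x ≤ phiConj X Φ g y) ∧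
    LowerC1On (E := EuclideanSpace ℝ (Fin n)) (fun y => (phiConj X Φ g y).toReal) Y := by
  constructor
  · intro y₀ hy₀
    obtain ⟨V, hVc, hVY, hV, K, hKX, hK, hprox⟩ :=
      hG.exists_isCompact_proxSet_subset hXcl hYop hΦc hy₀
    have hsub := fun y hy => (hprox y hy).2
    refine ⟨V, hVc, hVY, hV, hG.isCompact_biUnion_proxSet hK hVc hKX hVY hΦc hsub,
      hG.continuousOn_toReal_biUnion_proxSet hK hVc hKX hVY hΦc hsub, fun y hy => ⟨?_, ?_⟩⟩
    · obtain ⟨x, hx⟩ := (hprox y hy).1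
      exact ⟨x, mem_biUnion hy hx, phiConj_eq_of_mem_proxSet hG.ne_bot hx⟩
    · intro x hx
      simp only [mem_iUnion, exists_prop] at hx
      obtain ⟨y', -, hx⟩ := hx
      exact sub_le_phiConj hx.1
  · intro y₀ hy₀
    obtain ⟨V, hVc, hVY, hV, K, hKX, hK, hprox⟩ :=
      hG.exists_isCompact_proxSet_subset hXcl hYop hΦc hy₀
    have hsub := fun y hy => (hprox y hy).2
    have hO : IsOpen (interior X ×ˢ Y) := isOpen_interior.prod hYop
    have hZint : (⋃ y ∈ V, proxSet X Φ g y) ⊆ interior X :=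
      iUnion₂_subset fun y hy => hG.ran_interior y (hVY hy)
    have hZV := prod_mono hZint hVY
    have hconj {x y} (hx : x ∈ proxSet X Φ g y) :
        (phiConj X Φ g y).toReal = Φ x y - (g x).toReal := by
      rw [phiConj_eq_of_mem_proxSet hG.ne_bot hx, EReal.toReal_sub (EReal.coe_ne_top _)
        (EReal.coe_ne_bot _) (hG.ne_top_of_mem_proxSet hx) (hG.ne_bot x), EReal.toReal_coe]
    refine ⟨V, ⋃ y ∈ V, proxSet X Φ g y, fun x y => Φ x y - (g x).toReal, fun x y =>
      (InnerProductSpace.toDual ℝ (EuclideanSpace ℝ (Fin m))).symm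
        ((fderiv ℝ (fun p : EuclideanSpace ℝ (Fin n) × EuclideanSpace ℝ (Fin m) => Φ p.1 p.2)
          (x, y)).comp (ContinuousLinearMap.inr ℝ _ _)), hV,
      hG.isCompact_biUnion_proxSet hK hVc hKX hVY hΦc hsub, ?_, ?_,
      (continuousOn_gradient_snd hO hΦd).mono hZV, fun x hx y hy => ?_, fun y hy => ⟨?_, ?_⟩⟩
    · obtain ⟨x, hx⟩ := (hprox y₀ (mem_of_mem_nhds hV)).1
      exact ⟨x, mem_biUnion (mem_of_mem_nhds hV) hx⟩
    · exact (hΦd.continuousOn.mono hZV).sub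
        ((hG.continuousOn_toReal_biUnion_proxSet hK hVc hKX hVY hΦc hsub).comp
          continuousOn_fst fun p hp => hp.1)
    · have hd := (hΦd.differentiableOn one_ne_zero).differentiableAt
        (hO.mem_nhds (hZV (mk_mem_prod hx hy)))
      exact (hasGradientAt_snd hd).hasFDerivAt.sub_const _
    · obtain ⟨x, hx⟩ := (hprox y hy).1
      exact ⟨x, mem_biUnion hy hx, hconj hx⟩
    · intro x hx
      simp only [mem_iUnion, exists_prop] at hx
      obtain ⟨y', -, hx⟩ := hx
      obtain ⟨z, hz⟩ := (hprox y hy).1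
      beta_reduce
      rw [hconj hz]
      have := hG.toReal_le_of_mem_proxSet hz hx.1 (hG.ne_top_of_mem_proxSet hx)
      linarith

end
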